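/- Let S² be the unit sphere in ℝ³ with canonical surface measure σ, and for x ∈ S² let P(x) = I₃ − xxᵀ. Let V ⊆ S² be a nonempty relatively open subset whose relative boundary ∂V in S² is a smooth embedded closed curve. Let f₁ : ℝ³ → ℝ be continuously differentiable with f₁(x') = 0 for every x' ∈ ∂V, and let f₂ : ℝ³ → ℝ be twice continuously differentiable on a neighborhood of the closure of V. Then ∫_V f₁(x) Δ_M f₂(x) dσ(x) + ∫_V ⟨P(x)∇f₁(x), P(x)∇f₂(x)⟩ dσ(x) = 0. -/

import Mathlib

open MeasureTheory Real
open scoped RealInnerProductSpace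

noncomputable section

/-- Euclidean 3-space. -/
abbrev E3 : Type := EuclideanSpace ℝ (Fin 3)

/-- The orthogonal projection matrix `P(x) = I₃ - x xᵀ` applied to a vector `v`. -/
def sphProj (x v : E3) : E3 := v - (⟪x, v⟫) • x

/-- `tr (P(x) ⬝ J(x))` where `J(x)` is the Jacobian matrix at `x` of `F : ℝ³ → ℝ³`
(using symmetry of `P(x)`: `tr (P J) = ∑ i ⟪P eᵢ, J eᵢ⟫`). -/
def trProjJac (F : E3 → E3) (x : E3) : ℝ :=
  ∑ i : Fin 3, ⟪sphProj x (EuclideanSpace.single i 1), fderiv ℝ F x (EuclideanSpace.single i 1)⟫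

/-- The Laplace–Beltrami operator on the unit sphere `S² ⊂ ℝ³`:
`Δ_M u (x) = tr (P(x) ⬝ J(x))` where `J(x)` is the Jacobian at `x` of `y ↦ P(y) ∇u(y)`. -/
def lapBel (u : E3 → ℝ) (x : E3) : ℝ :=
  trProjJac (fun y => sphProj y (gradient u y)) x

/-- The (Euclidean) score function `∇ log f`. -/
def gradLog (f : E3 → ℝ) (x : E3) : E3 := gradient (fun y => Real.log (f y)) x

/-- `s` is a smooth embedded closed curve in `ℝ³`. -/
def IsSmoothEmbeddedClosedCurve (s : Set E3) : Prop :=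
  ∃ γ : ℝ → E3, ContDiff ℝ (⊤ : ℕ∞) γ ∧ Function.Periodic γ (2 * π) ∧
    (∀ t, deriv γ t ≠ 0) ∧ Set.InjOn γ (Set.Ico 0 (2 * π)) ∧ Set.range γ = s


lemma oneD (O C : Set ℝ) (hO : IsOpen O) (hC : IsClosed C) (hOC : O ⊆ C) (h h' : ℝ → ℝ)
    (hd : ∀ t ∈ C, HasDerivAt h (h' t) t) (hz : ∀ t ∈ C, t ∉ O → h t = 0) (a b : ℝ)
    (hi : IntervalIntegrable (O.indicator h') volume a b) :
    ∫ t in a..b, O.indicator h' t = O.indicator h b - O.indicator h a := by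
  have hin : ∀ t ∈ O, O.indicator h =ᶠ[nhds t] h := fun t ht => by
    filter_upwards [hO.mem_nhds ht] with s hs
    simp [hs]
  have hout : ∀ t, t ∉ C → O.indicator h =ᶠ[nhds t] fun _ => (0:ℝ) := fun t ht => by
    filter_upwards [hC.isOpen_compl.mem_nhds ht] with s hs
    exact Set.indicator_of_notMem (fun h => hs (hOC h)) _
  have hle : ∀ s, ‖O.indicator h s‖ ≤ ‖h s‖ := fun s => norm_indicator_le_norm_self _ _
  set S : Set ℝ := {t | t ∈ C ∧ t ∉ O ∧ h' t ≠ 0} with hS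
  have hScount : S.Countable := by
    have : DiscreteTopology S := by
      rw [discreteTopology_subtype_iff]
      intro t ht
      have h1 : ∀ᶠ s in nhdsWithin t {t}ᶜ, h s ≠ 0 := by
        have := (hd t ht.1).eventually_ne ht.2.2 (c := 0)
        exact this
      rw [← Filter.empty_mem_iff_bot, Filter.mem_inf_iff]
      refine ⟨_, h1, S, Filter.mem_principal_self S, ?_⟩
      ext s
      simp only [Set.mem_empty_iff_false, Set.mem_inter_iff, false_iff, not_and]
      intro hs hs'
      exact hs (hz s hs'.1 hs'.2.1)
    have : Countable S := TopologicalSpace.separableSpace_iff_countable.1 inferInstance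
    exact Set.countable_coe_iff.1 this
  refine integral_eq_of_hasDerivAt_off_countable _ _ hScount ?_ ?_ hi
  · refine Continuous.continuousOn (continuous_iff_continuousAt.2 fun t => ?_)
    by_cases htC : t ∈ C
    · by_cases htO : t ∈ O
      · exact (hd t htC).continuousAt.congr (hin t htO).symm
      · have h0 : O.indicator h t = 0 := by simp [htO]
        unfold ContinuousAt
        rw [h0]
        refine squeeze_zero_norm hle ?_
        have := (hd t htC).continuousAt.norm
        unfold ContinuousAt at this
        simpa only [hz t htC htO, norm_zero] using this
    · exact continuousAt_const.congr (hout t htC).symm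
  · rintro t ⟨-, htS⟩
    by_cases htC : t ∈ C
    · by_cases htO : t ∈ O
      · rw [Set.indicator_of_mem htO]
        exact (hd t htC).congr_of_eventuallyEq (hin t htO)
      · rw [Set.indicator_of_notMem htO]
        have h0 : h' t = 0 := by
          by_contra hne
          exact htS ⟨htC, htO, hne⟩
        have := hd t htC
        rw [h0, hasDerivAt_iff_isLittleO, hz t htC htO] at this
        rw [hasDerivAt_iff_isLittleO, Set.indicator_of_notMem htO]
        simp only [smul_zero, sub_zero] at this ⊢
        exact (Asymptotics.isBigO_of_le _ hle).trans_isLittleO this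
    · rw [Set.indicator_of_notMem (fun h => htC (hOC h))]
      exact (hasDerivAt_const t (0:ℝ)).congr_of_eventuallyEq (hout t htC)

def vf (k : Fin 3) (x : E3) : E3 :=
  match k with
  | 0 => !₂[0, - x 2, x 1]
  | 1 => !₂[x 2, 0, - x 0]
  | 2 => !₂[- x 1, x 0, 0]

def rot (k : Fin 3) (t : ℝ) (x : E3) : E3 :=
  match k with
  | 0 => !₂[x 0, cos t * x 1 - sin t * x 2, sin t * x 1 + cos t * x 2]
  | 1 => !₂[cos t * x 0 + sin t * x 2, x 1, - sin t * x 0 + cos t * x 2]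
  | 2 => !₂[cos t * x 0 - sin t * x 1, sin t * x 0 + cos t * x 1, x 2]

lemma rot_left (k : Fin 3) (t : ℝ) (x : E3) : rot k (-t) (rot k t x) = x := by
  have := sin_sq_add_cos_sq t
  fin_cases k <;> ext i <;> fin_cases i <;> simp [rot] <;> grind

lemma rot_right (k : Fin 3) (t : ℝ) (x : E3) : rot k t (rot k (-t) x) = x := by
  have := rot_left k (-t) x
  rwa [neg_neg] at this

lemma rot_isom (k : Fin 3) (t : ℝ) : Isometry (rot k t) := by
  refine Isometry.of_dist_eq fun x y => ?_
  have := sin_sq_add_cos_sq t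
  rw [EuclideanSpace.dist_eq, EuclideanSpace.dist_eq]
  congr 1
  simp only [Fin.sum_univ_three, Real.dist_eq, sq_abs]
  fin_cases k <;> simp [rot] <;> grind

lemma rot_zero (k : Fin 3) (x : E3) : rot k 0 x = x := by
  fin_cases k <;> ext i <;> fin_cases i <;> simp [rot]

lemma rot_two_pi (k : Fin 3) (x : E3) : rot k (2 * π) x = x := by
  fin_cases k <;> ext i <;> fin_cases i <;> simp [rot]

lemma rot_norm (k : Fin 3) (t : ℝ) (x : E3) : ‖rot k t x‖ = ‖x‖ := by
  have h0 : rot k t 0 = 0 := by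
    fin_cases k <;> ext i <;> fin_cases i <;> simp [rot]
  have := (rot_isom k t).dist_eq x 0
  rwa [h0, dist_zero_right, dist_zero_right] at this

lemma rot_cont (k : Fin 3) : Continuous (fun p : ℝ × E3 => rot k p.1 p.2) := by
  refine (PiLp.continuous_toLp 2 _).comp (f := fun p : ℝ × E3 => (rot k p.1 p.2).ofLp) ?_
  refine continuous_pi fun i => ?_
  fin_cases k <;> fin_cases i <;> simp [rot] <;> fun_prop

lemma rot_deriv (k : Fin 3) (x : E3) (t : ℝ) :
    HasDerivAt (fun s => rot k s x) (vf k (rot k t x)) t := by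
  suffices H : HasDerivAt (fun s => (rot k s x).ofLp) (vf k (rot k t x)).ofLp t from
    (EuclideanSpace.equiv (Fin 3) ℝ).symm.hasFDerivAt.comp_hasDerivAt t H
  rw [hasDerivAt_pi]
  intro i
  have hs := hasDerivAt_sin t
  have hc := hasDerivAt_cos t
  fin_cases k <;> fin_cases i <;> simp [rot, vf]
  · exact hasDerivAt_const _ _
  · exact ((hc.mul_const (x 1)).sub (hs.mul_const (x 2))).congr_deriv (by ring)
  · exact ((hs.mul_const (x 1)).add (hc.mul_const (x 2))).congr_deriv (by ring)
  · exact ((hc.mul_const (x 0)).add (hs.mul_const (x 2))).congr_deriv (by ring)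
  · exact hasDerivAt_const _ _
  · exact ((hs.mul_const (x 0)).neg.add (hc.mul_const (x 2))).congr_deriv (by ring)
  · exact ((hc.mul_const (x 0)).sub (hs.mul_const (x 1))).congr_deriv (by ring)
  · exact ((hs.mul_const (x 0)).add (hc.mul_const (x 1))).congr_deriv (by ring)
  · exact hasDerivAt_const _ _

lemma vf_contDiff (k : Fin 3) : ContDiff ℝ ⊤ (vf k) := by
  rw [contDiff_euclidean]
  intro i
  fin_cases k <;> fin_cases i <;> simp [vf] <;> fun_prop

lemma rot_mp (k : Fin 3) (t : ℝ) :
    MeasurePreserving (rot k t) (μH[2].restrict (Metric.sphere (0:E3) 1))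
      (μH[2].restrict (Metric.sphere (0:E3) 1)) := by
  let e : E3 ≃ᵢ E3 := ⟨⟨rot k t, rot k (-t), rot_left k t, rot_right k t⟩, rot_isom k t⟩
  have h1 := e.measurePreserving_hausdorffMeasure 2
  have h2 := h1.restrict_preimage (s := Metric.sphere (0:E3) 1) Metric.isClosed_sphere.measurableSet
  have h3 : e ⁻¹' (Metric.sphere (0:E3) 1) = Metric.sphere (0:E3) 1 := by
    ext x
    simp only [Set.mem_preimage, mem_sphere_zero_iff_norm]
    rw [show e x = rot k t x from rfl, rot_norm]
  rw [h3] at h2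
  exact h2

def sph (p : Fin 2 → ℝ) : E3 := !₂[sin (p 0) * cos (p 1), sin (p 0) * sin (p 1), cos (p 0)]

lemma sphere_finite : μH[2] (Metric.sphere (0:E3) 1) < ⊤ := by
  have hsm : ContDiff ℝ 1 sph := by
    rw [contDiff_euclidean]
    intro i
    fin_cases i <;> simp [sph] <;> fun_prop
  set K : Set (Fin 2 → ℝ) := Set.Icc (fun _ => -4) (fun _ => 4)
  obtain ⟨L, hL⟩ := hsm.contDiffOn.exists_lipschitzOnWith (s := K) one_ne_zero (convex_Icc _ _) isCompact_Icc
  have h1 := hL.hausdorffMeasure_image_le (d := 2) (by norm_num)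
  have h2 : (μH[2] : Measure (Fin 2 → ℝ)) = volume := by
    have := hausdorffMeasure_pi_real (ι := Fin 2)
    simpa using this
  have hsub : Metric.sphere (0:E3) 1 ⊆ sph '' K := by
    intro x hx
    rw [mem_sphere_zero_iff_norm, EuclideanSpace.norm_eq, Real.sqrt_eq_one] at hx
    simp only [Fin.sum_univ_three, Real.norm_eq_abs, sq_abs] at hx
    set z : ℂ := ⟨x 0, x 1⟩ with hz
    have hzn : ‖z‖ = Real.sqrt (1 - x 2 ^ 2) := by
      rw [Complex.norm_def, Complex.normSq_apply]
      congr 1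
      simp [hz]; linarith
    have hcs : cos (arccos (x 2)) = x 2 := Real.cos_arccos (by nlinarith [sq_nonneg (x 0), sq_nonneg (x 1)]) (by nlinarith [sq_nonneg (x 0), sq_nonneg (x 1)])
    have hsn : sin (arccos (x 2)) = ‖z‖ := by rw [Real.sin_arccos, hzn]
    refine ⟨![arccos (x 2), z.arg], ⟨?_, ?_⟩, ?_⟩
    · intro i
      have := Complex.neg_pi_lt_arg z
      have := arccos_nonneg (x 2)
      have := pi_lt_four
      fin_cases i <;> simp <;> linarith
    · intro i
      have := Complex.arg_le_pi z
      have := arccos_le_pi (x 2)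
      have := pi_lt_four
      fin_cases i <;> simp <;> linarith
    · ext i
      fin_cases i <;> simp only [sph, hcs, hsn] <;> simp [hcs, hsn, Complex.norm_mul_cos_arg, Complex.norm_mul_sin_arg, hz]
  refine (measure_mono hsub).trans_lt (h1.trans_lt ?_)
  rw [h2]
  exact ENNReal.mul_lt_top (by simp) isCompact_Icc.measure_lt_top

lemma int_zero (k : Fin 3) (V : Set E3) (hVsub : V ⊆ Metric.sphere (0 : E3) 1)
    (hVopen : ∃ W : Set E3, IsOpen W ∧ V = W ∩ Metric.sphere (0 : E3) 1)
    (h : E3 → ℝ) (hh : ∀ x ∈ closure V, DifferentiableAt ℝ h x)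
    (hq : ContinuousOn (fun x => fderiv ℝ h x (vf k x)) (closure V))
    (hz : ∀ x ∈ closure V \ V, h x = 0) :
    ∫ x in V, fderiv ℝ h x (vf k x) ∂μH[2] = 0 := by
  obtain ⟨W, hW, hVW⟩ := hVopen
  have hclS : closure V ⊆ Metric.sphere (0 : E3) 1 :=
    closure_minimal hVsub Metric.isClosed_sphere
  have hcomp : IsCompact (closure V) := (isCompact_sphere (0:E3) 1).of_isClosed_subset isClosed_closure hclS
  have hVm : MeasurableSet V := by
    rw [hVW]; exact hW.measurableSet.inter Metric.isClosed_sphere.measurableSet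
  set q : E3 → ℝ := fun x => fderiv ℝ h x (vf k x) with hqdef
  set μ : Measure E3 := μH[2].restrict (Metric.sphere (0:E3) 1) with hμ
  have : IsFiniteMeasure μ := ⟨by rw [hμ, Measure.restrict_apply_univ]; exact sphere_finite⟩
  set φ : E3 → ℝ := V.indicator q with hφ
  obtain ⟨M, hM⟩ := hcomp.exists_bound_of_continuousOn hq
  have hφb : ∀ x, ‖φ x‖ ≤ |M| := fun x => by
    by_cases hx : x ∈ V
    · rw [hφ, Set.indicator_of_mem hx]
      exact (hM x (subset_closure hx)).trans (le_abs_self _)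
    · rw [hφ, Set.indicator_of_notMem hx]; simp
  have hφm : Measurable φ := by
    classical
    have := (hq.mono subset_closure).measurable_piecewise (g := fun _ => (0:ℝ)) continuousOn_const hVm
      (s := V)
    have h0 : V.piecewise q (fun _ => (0:ℝ)) = V.indicator q := Set.piecewise_eq_indicator
    rwa [h0] at this
  have e1 : ∫ x in V, q x ∂μH[2] = ∫ x, φ x ∂μ := by
    rw [hφ, integral_indicator hVm, hμ, Measure.restrict_restrict hVm,
      Set.inter_eq_left.2 hVsub]
  have e2 : ∀ t, ∫ x, φ (rot k t x) ∂μ = ∫ x, φ x ∂μ := fun t => by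
    have hemb : MeasurableEmbedding (rot k t) :=
      ((rot_isom k t).isClosedEmbedding).measurableEmbedding
    exact (rot_mp k t).integral_comp hemb φ
  have hmeas : Measurable (fun p : ℝ × E3 => φ (rot k p.1 p.2)) :=
    hφm.comp (rot_cont k).measurable
  have e3 : ∫ t in Set.Ioc 0 (2 * π), ∫ x, φ (rot k t x) ∂μ
      = ∫ x, (∫ t in Set.Ioc 0 (2 * π), φ (rot k t x)) ∂μ := by
    apply integral_integral_swap
    refine Integrable.of_bound hmeas.aestronglyMeasurable |M| ?_
    exact Filter.Eventually.of_forall fun p => hφb _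
  have e4 : ∀ x ∈ Metric.sphere (0:E3) 1, ∫ t in Set.Ioc 0 (2 * π), φ (rot k t x) = 0 := by
    intro x hx
    have hrS : ∀ t, rot k t x ∈ Metric.sphere (0:E3) 1 := fun t => by
      rw [mem_sphere_zero_iff_norm, rot_norm]; simpa using hx
    have hrc : Continuous (fun t => rot k t x) := (rot_cont k).comp (by fun_prop : Continuous fun t : ℝ => (t, x))
    have hO : IsOpen ((fun t => rot k t x) ⁻¹' V) := by
      have : (fun t => rot k t x) ⁻¹' V = (fun t => rot k t x) ⁻¹' W := by
        ext t
        simp only [Set.mem_preimage, hVW, Set.mem_inter_iff, hrS t, and_true]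
      rw [this]; exact hW.preimage hrc
    have key := oneD ((fun t => rot k t x) ⁻¹' V) ((fun t => rot k t x) ⁻¹' closure V) hO
      (isClosed_closure.preimage hrc) (Set.preimage_mono subset_closure)
      (fun t => h (rot k t x)) (fun t => q (rot k t x))
      (fun t ht => (hh _ ht).hasFDerivAt.comp_hasDerivAt t (rot_deriv k x t))
      (fun t ht ht' => hz _ ⟨ht, ht'⟩) 0 (2 * π)
      (by
        have hm : Measurable (fun t => φ (rot k t x)) := hφm.comp hrc.measurable
        rw [intervalIntegrable_iff, Set.uIoc_of_le (by positivity)]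
        exact Integrable.of_bound (C := |M|) hm.aestronglyMeasurable (Filter.Eventually.of_forall fun t => hφb _))
    rw [intervalIntegral.integral_of_le (by positivity)] at key
    refine Eq.trans key ?_
    have hI : ∀ t, rot k t x = x → ((fun t => rot k t x) ⁻¹' V).indicator
        (fun t => h (rot k t x)) t = V.indicator h x := by
      intro t ht
      have : ((fun t => rot k t x) ⁻¹' V).indicator (h ∘ fun t => rot k t x) t
          = V.indicator h (rot k t x) := by
        by_cases hm : rot k t x ∈ V
        · rw [Set.indicator_of_mem hm, Set.indicator_of_mem (by exact hm)]; rfl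
        · rw [Set.indicator_of_notMem hm, Set.indicator_of_notMem (by exact hm)]
      rw [ht] at this
      exact this
    rw [hI 0 (rot_zero k x), hI (2 * π) (rot_two_pi k x), sub_self]
  have e5 : ∫ x, (∫ t in Set.Ioc 0 (2 * π), φ (rot k t x)) ∂μ = 0 := by
    rw [hμ, setIntegral_congr_fun Metric.isClosed_sphere.measurableSet e4]
    simp
  rw [e5] at e3
  simp only [e2] at e3
  rw [setIntegral_const] at e3
  simp only [smul_eq_mul, mul_eq_zero, Measure.real, Real.volume_Ioc, sub_zero] at e3
  rw [ENNReal.toReal_ofReal (by positivity)] at e3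
  rw [e1]
  exact e3.resolve_left (by positivity)

def vfL (k : Fin 3) : E3 →L[ℝ] E3 :=
  LinearMap.toContinuousLinearMap
    { toFun := vf k
      map_add' := fun x y => by
        fin_cases k <;> ext i <;> fin_cases i <;> simp [vf] <;> ring
      map_smul' := fun c x => by
        fin_cases k <;> ext i <;> fin_cases i <;> simp [vf] }

lemma lin_expand (L : E3 →L[ℝ] E3) (v : E3) :
    L v = v 0 • L (EuclideanSpace.single 0 1) + v 1 • L (EuclideanSpace.single 1 1)
      + v 2 • L (EuclideanSpace.single 2 1) := by
  have : v = v 0 • EuclideanSpace.single 0 1 + v 1 • EuclideanSpace.single 1 1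
      + v 2 • EuclideanSpace.single (2 : Fin 3) (1:ℝ) := by
    ext i; fin_cases i <;> simp
  conv_lhs => rw [this]
  simp only [map_add, map_smul]

lemma fderiv_h (k : Fin 3) (f₁ : E3 → ℝ) (G : E3 → E3) (x : E3)
    (h1 : DifferentiableAt ℝ f₁ x) (hG : DifferentiableAt ℝ G x) :
    fderiv ℝ (fun y => f₁ y * ⟪vf k y, G y⟫) x (vf k x)
      = ⟪gradient f₁ x, vf k x⟫ * ⟪vf k x, G x⟫
        + f₁ x * (⟪vf k (vf k x), G x⟫ + ⟪vf k x, fderiv ℝ G x (vf k x)⟫) := by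
  have hv : HasFDerivAt (vf k) (vfL k) x := (vfL k).hasFDerivAt
  have h2 := h1.hasFDerivAt.mul (hv.inner ℝ hG.hasFDerivAt)
  have h3 : fderiv ℝ f₁ x (vf k x) = ⟪gradient f₁ x, vf k x⟫ := by
    rw [← toDual_gradient, InnerProductSpace.toDual_apply_apply]
  have h4 : vfL k (vf k x) = vf k (vf k x) := rfl
  have h5 : HasFDerivAt (fun y => f₁ y * ⟪vf k y, G y⟫) _ x := h2
  rw [h5.fderiv]
  simp only [_root_.add_apply, _root_.smul_apply, smul_eq_mul,
    ContinuousLinearMap.comp_apply, ContinuousLinearMap.prod_apply, fderivInnerCLM_apply, h3, h4]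
  ring

lemma trProj_eq (G : E3 → E3) (x : E3) (hG : DifferentiableAt ℝ G x) :
    trProjJac (fun y => sphProj y (G y)) x = ∑ i : Fin 3,
      ⟪sphProj x (EuclideanSpace.single i 1),
        fderiv ℝ G x (EuclideanSpace.single i 1)
        - ((⟪x, G x⟫) • EuclideanSpace.single i 1
        + (⟪x, fderiv ℝ G x (EuclideanSpace.single i 1)⟫ +
          ⟪EuclideanSpace.single i 1, G x⟫) • x)⟫ := by
  have h2 := hG.hasFDerivAt.sub (((hasFDerivAt_id x).inner ℝ hG.hasFDerivAt).smul (hasFDerivAt_id x))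
  have h5 : HasFDerivAt (fun y => sphProj y (G y)) _ x := h2
  unfold trProjJac
  rw [h5.fderiv]
  simp

lemma pointwise (f₁ : E3 → ℝ) (G : E3 → E3) (x : E3) (hx : ‖x‖ = 1)
    (h1 : DifferentiableAt ℝ f₁ x) (hG : DifferentiableAt ℝ G x) :
    f₁ x * trProjJac (fun y => sphProj y (G y)) x + ⟪sphProj x (gradient f₁ x), sphProj x (G x)⟫
      = ∑ k : Fin 3, fderiv ℝ (fun y => f₁ y * ⟪vf k y, G y⟫) x (vf k x) := by
  rw [trProj_eq G x hG]
  simp only [fderiv_h _ f₁ G x h1 hG]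
  rw [EuclideanSpace.norm_eq, Real.sqrt_eq_one] at hx
  simp only [Fin.sum_univ_three, Real.norm_eq_abs, sq_abs] at hx
  simp only [Fin.sum_univ_three]
  rw [lin_expand (fderiv ℝ G x) (vf 0 x), lin_expand (fderiv ℝ G x) (vf 1 x),
    lin_expand (fderiv ℝ G x) (vf 2 x)]
  generalize fderiv ℝ G x (EuclideanSpace.single 0 1) = H0
  generalize fderiv ℝ G x (EuclideanSpace.single 1 1) = H1
  generalize fderiv ℝ G x (EuclideanSpace.single 2 1) = H2
  generalize gradient f₁ x = D
  generalize G x = g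
  generalize f₁ x = c
  simp [sphProj, vf, PiLp.inner_apply, Fin.sum_univ_three]
  linear_combination (-(c * (H0 0 + H1 1 + H2 2 - 2 * (x 0 * g 0 + x 1 * g 1 + x 2 * g 2)
      - (x 0 * (x 0 * H0 0 + x 1 * H0 1 + x 2 * H0 2) + x 1 * (x 0 * H1 0 + x 1 * H1 1 + x 2 * H1 2)
        + x 2 * (x 0 * H2 0 + x 1 * H2 1 + x 2 * H2 2)))
      + (D 0 * g 0 + D 1 * g 1 + D 2 * g 2)
      - (x 0 * D 0 + x 1 * D 1 + x 2 * D 2) * (x 0 * g 0 + x 1 * g 1 + x 2 * g 2))) * hx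

/-- **Green's identity on a truncated region of `S²` with `f₁` vanishing on the boundary
(Theorem 1).** -/
theorem green_identity_truncated_sphere
    (V : Set E3) (hVsub : V ⊆ Metric.sphere (0 : E3) 1) (hVne : V.Nonempty)
    (hVopen : ∃ W : Set E3, IsOpen W ∧ V = W ∩ Metric.sphere (0 : E3) 1)
    (hcurve : IsSmoothEmbeddedClosedCurve (closure V \ V))
    (f₁ f₂ : E3 → ℝ)
    (U : Set E3) (hUopen : IsOpen U) (hclVU : closure V ⊆ U)
    (hf₁ : ContDiff ℝ 1 f₁) (hf₂ : ContDiffOn ℝ 2 f₂ U)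
    (hf₁bd : ∀ x ∈ closure V \ V, f₁ x = 0) :
    (∫ x in V, f₁ x * lapBel f₂ x ∂μH[2])
      + (∫ x in V, ⟪sphProj x (gradient f₁ x), sphProj x (gradient f₂ x)⟫ ∂μH[2]) = 0 := by
  have hclS : closure V ⊆ Metric.sphere (0 : E3) 1 :=
    closure_minimal hVsub Metric.isClosed_sphere
  have hcomp : IsCompact (closure V) :=
    (isCompact_sphere (0:E3) 1).of_isClosed_subset isClosed_closure hclS
  have hVm : MeasurableSet V := by
    obtain ⟨W, hW, hVW⟩ := hVopen
    rw [hVW]; exact hW.measurableSet.inter Metric.isClosed_sphere.measurableSet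
  have hfin : μH[2] (closure V) < ⊤ := (measure_mono hclS).trans_lt sphere_finite
  have hint : ∀ g : E3 → ℝ, ContinuousOn g (closure V) → IntegrableOn g V μH[2] := by
    intro g hg
    obtain ⟨M, hM⟩ := hcomp.exists_bound_of_continuousOn hg
    have : IntegrableOn g (closure V) μH[2] :=
      IntegrableOn.of_bound hfin (hg.aestronglyMeasurable isClosed_closure.measurableSet) M
        ((ae_restrict_iff' isClosed_closure.measurableSet).2 (Filter.Eventually.of_forall hM))
    exact this.mono_set subset_closure
  have hG : ContDiffOn ℝ 1 (gradient f₂) U := by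
    have h1 : ContDiffOn ℝ 1 (fderiv ℝ f₂) U := hf₂.fderiv_of_isOpen hUopen (by norm_num)
    exact (InnerProductSpace.toDual ℝ E3).symm.contDiff.comp_contDiffOn h1
  have hG1 : Continuous (gradient f₁) :=
    (InnerProductSpace.toDual ℝ E3).symm.continuous.comp (hf₁.continuous_fderiv one_ne_zero)
  have hF : ContDiffOn ℝ 1 (fun y => sphProj y (gradient f₂ y)) U :=
    hG.sub ((contDiffOn_id.inner ℝ hG).smul contDiffOn_id)
  have hlap : ContinuousOn (lapBel f₂) U := by
    have h1 := hF.continuousOn_fderiv_of_isOpen hUopen le_rfl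
    have h2 : ContinuousOn (fun x => ∑ i : Fin 3,
      ⟪(EuclideanSpace.single i 1 : E3) - (⟪x, (EuclideanSpace.single i 1 : E3)⟫) • x,
      fderiv ℝ (fun y => sphProj y (gradient f₂ y)) x (EuclideanSpace.single i 1)⟫) U := by
      refine continuousOn_finset_sum _ fun i _ => ?_
      refine ContinuousOn.inner ?_ (h1.clm_apply continuousOn_const)
      fun_prop
    exact h2
  have hA : IntegrableOn (fun x => f₁ x * lapBel f₂ x) V μH[2] :=
    hint _ (hf₁.continuous.continuousOn.mul (hlap.mono hclVU))
  have hB : IntegrableOn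
      (fun x => ⟪sphProj x (gradient f₁ x), sphProj x (gradient f₂ x)⟫) V μH[2] := by
    refine hint _ (ContinuousOn.inner ?_ (hF.continuousOn.mono hclVU))
    have : Continuous (fun x : E3 => gradient f₁ x - (⟪x, gradient f₁ x⟫) • x) := by fun_prop
    exact this.continuousOn
  have hh : ∀ k : Fin 3, ContDiffOn ℝ 1 (fun y => f₁ y * ⟪vf k y, gradient f₂ y⟫) U := fun k =>
    hf₁.contDiffOn.mul (((vf_contDiff k).of_le le_top).contDiffOn.inner ℝ hG)
  have hq : ∀ k : Fin 3, ContinuousOn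
      (fun x => fderiv ℝ (fun y => f₁ y * ⟪vf k y, gradient f₂ y⟫) x (vf k x)) (closure V) :=
    fun k => (((hh k).continuousOn_fderiv_of_isOpen hUopen le_rfl).clm_apply
      (vf_contDiff k).continuous.continuousOn).mono hclVU
  rw [← integral_add hA hB]
  have heq : ∀ x ∈ V, f₁ x * lapBel f₂ x
      + ⟪sphProj x (gradient f₁ x), sphProj x (gradient f₂ x)⟫
      = ∑ k : Fin 3, fderiv ℝ (fun y => f₁ y * ⟪vf k y, gradient f₂ y⟫) x (vf k x) := by
    intro x hx
    exact pointwise f₁ (gradient f₂) x (by simpa using hVsub hx)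
      ((hf₁.differentiable one_ne_zero) x)
      ((hG.differentiableOn one_ne_zero).differentiableAt
        (hUopen.mem_nhds (hclVU (subset_closure hx))))
  rw [setIntegral_congr_fun hVm heq, integral_finset_sum _ fun k _ => hint _ (hq k)]
  refine Finset.sum_eq_zero fun k _ => ?_
  refine int_zero k V hVsub hVopen _ (fun x hx => ?_) (hq k) (fun x hx => ?_)
  · exact ((hh k).differentiableOn one_ne_zero).differentiableAt (hUopen.mem_nhds (hclVU hx))
  · simp [hf₁bd x hx]
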